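/- Let n ≥ 2, let α < α′ be adjacent in L_n, let m be a divisor of n with 2 ≤ m < n, and suppose f̂ ∈ L_m satisfies α < f̂ < α′. Then α′ = f̂ ⋆ λ, where λ is the least element of L_{n/m}. -/

import Mathlib

/-!
Common definitions: α-sequences, the lexical order, elementary operations,
lexical sequences, harmonics, star products, etc.
-/

/-- The sign-alternating sequence `Al(τ)` associated to an α-sequence `τ`
(0-indexed: entry `i` of `Al τ` is `(-1)^i * τ_{i+1}`, and `0` beyond the length). -/
def Al (τ : List ℕ) (i : ℕ) : ℤ := (-1 : ℤ) ^ i * (τ.getD i 0 : ℤ)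

/-- The (strict) lexical order: `τ < τ'` iff the first nonzero entry of
`Al τ - Al τ'` is negative. -/
def lexLt (τ τ' : List ℕ) : Prop :=
  ∃ i, (∀ j < i, Al τ j = Al τ' j) ∧ Al τ i < Al τ' i

/-- An α-sequence: a nonempty finite sequence of positive integers. -/
def IsAlphaSeq (α : List ℕ) : Prop := α ≠ [] ∧ ∀ x ∈ α, 0 < x

/-- `Aset n` is the set `A_n` of α-sequences of degree `n`. -/
def Aset (n : ℕ) : Set (List ℕ) := {α | IsAlphaSeq α ∧ α.sum = n}

/-- Splitting operation `E_s` at the (1-indexed) cell `i`: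
`(α₁,…,α_{i-1}, α_i - 1, 1, α_{i+1},…,α_k)`. -/
def applyEs (α : List ℕ) (i : ℕ) : List ℕ :=
  α.take (i - 1) ++ [α.getD (i - 1) 0 - 1, 1] ++ α.drop i

/-- `E_s` is applicable at cell `i` iff `1 ≤ i ≤ l(α)` and `α_i > 1`. -/
def EsApplicable (α : List ℕ) (i : ℕ) : Prop :=
  1 ≤ i ∧ i ≤ α.length ∧ 1 < α.getD (i - 1) 0

/-- Conjugation operation `E_c` at the (1-indexed) cell `i`:
`(α₁,…,α_{i-2}, α_{i-1} + 1, α_{i+1},…,α_k)`. -/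
def applyEc (α : List ℕ) (i : ℕ) : List ℕ :=
  α.take (i - 2) ++ [α.getD (i - 2) 0 + 1] ++ α.drop i

/-- `E_c` is applicable at cell `i` iff `2 ≤ i ≤ l(α)` and `α_i = 1`. -/
def EcApplicable (α : List ℕ) (i : ℕ) : Prop :=
  2 ≤ i ∧ i ≤ α.length ∧ α.getD (i - 1) 0 = 1

/-- `α'` is obtained from `α` by applying one elementary operation (`E_s` or `E_c`)
at the (1-indexed) cell `i`. -/
def ElemOpAt (α : List ℕ) (i : ℕ) (α' : List ℕ) : Prop :=
  (EsApplicable α i ∧ α' = applyEs α i) ∨ (EcApplicable α i ∧ α' = applyEc α i)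

/-- `a < b` and `a`, `b` are adjacent in `S`: no element of `S` lies strictly between. -/
def AdjLtIn (S : Set (List ℕ)) (a b : List ℕ) : Prop :=
  lexLt a b ∧ ∀ γ ∈ S, ¬ (lexLt a γ ∧ lexLt γ b)

/-- An α-sequence is lexical iff it strictly exceeds all of its proper right sequences. -/
def IsLexical (α : List ℕ) : Prop :=
  IsAlphaSeq α ∧ ∀ i, 2 ≤ i → i ≤ α.length → lexLt (α.drop (i - 1)) α

/-- `Lset n` is the set `L_n` of lexical sequences `α` with `1 + D(α) = n`. -/
def Lset (n : ℕ) : Set (List ℕ) := {α | IsLexical α ∧ 1 + α.sum = n}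

/-- Add `1` to the last entry of a list. -/
def bumpLast (α : List ℕ) : List ℕ := α.dropLast ++ [α.getD (α.length - 1) 0 + 1]

/-- `α_e`: the even-length modification of `α`. -/
def seqE (α : List ℕ) : List ℕ := if Even α.length then bumpLast α else α ++ [1]

/-- `α_o`: the odd-length modification of `α`. -/
def seqO (α : List ℕ) : List ℕ := if Even α.length then α ++ [1] else bumpLast α

/-- The `j`-th harmonicSeq: `h_0(α) = α` and `h_j(α) = (h_{j-1}(α))_o h_{j-1}(α)`. -/
def harmonicSeq : ℕ → List ℕ → List ℕ
  | 0, α => α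
  | j + 1, α => seqO (harmonicSeq j α) ++ harmonicSeq j α

/-- A sequence is fundamental iff it is not a harmonicSeq `h_j(β)`, `j ≥ 1`,
of any α-sequence `β`. -/
def IsFundamental (α : List ℕ) : Prop :=
  ∀ β : List ℕ, IsAlphaSeq β → ∀ j, 1 ≤ j → α ≠ harmonicSeq j β

/-- `α^q`: the `q`-fold concatenation of `α` with itself. -/
def nrep (α : List ℕ) (q : ℕ) : List ℕ := (List.replicate q α).flatten

/-- The star product
`α ⋆ β = α_o (α_e)^{β₁-1} α_o (α_e)^{β₂-1} ⋯ α_o (α_e)^{β_k-1} α`. -/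
def starProd (α β : List ℕ) : List ℕ :=
  (β.map (fun b => seqO α ++ nrep (seqE α) (b - 1))).flatten ++ α

/-- `α ∧ β`: the longest common left factor, ended by the minimum of the
first differing entries. -/
def wedge : List ℕ → List ℕ → List ℕ
  | [], _ => []
  | _, [] => []
  | a :: as, b :: bs => if a = b then a :: wedge as bs else [min a b]

/-- `a` is the least element of `S` in the lexical order. -/
def LeastIn (S : Set (List ℕ)) (a : List ℕ) : Prop :=
  a ∈ S ∧ ∀ b ∈ S, b ≠ a → lexLt a b

/-- `a` is the greatest element of `S` in the lexical order. -/
def GreatestIn (S : Set (List ℕ)) (a : List ℕ) : Prop :=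
  a ∈ S ∧ ∀ b ∈ S, b ≠ a → lexLt b a

/-- `i` is an even (1-indexed) cell of `α` at which the applicable elementary
operation yields a lexical sequence. -/
def GoodEvenIndex (α : List ℕ) (i : ℕ) : Prop :=
  Even i ∧ ∃ α', ElemOpAt α i α' ∧ IsLexical α'

/-- `i` is an odd (1-indexed) cell of `α` at which the applicable elementary
operation yields a lexical sequence. -/
def GoodOddIndex (α : List ℕ) (i : ℕ) : Prop :=
  Odd i ∧ ∃ α', ElemOpAt α i α' ∧ IsLexical α'

/-- The successor operation: apply whichever of `E_s`, `E_c` is applicable at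
the largest even (1-indexed) index `≤ l(α)`, i.e. on the tail of the longest
left sequence of even length. -/
def succOp (α : List ℕ) : List ℕ :=
  let i := if Even α.length then α.length else α.length - 1
  if 1 < α.getD (i - 1) 0 then applyEs α i else applyEc α i

/-- Parity of the number of `true` letters of a word. -/
def wordParity : List Bool → Bool
  | [] => false
  | x :: w => xor x (wordParity w)

/-- The parity-lexicographic order on words, where `false < (end of word) < true` and the
order is reversed after each letter `true`. -/
def wordLt : List Bool → List Bool → Prop
  | true :: a, true :: b => wordLt b a
  | false :: a, false :: b => wordLt a b
  | false :: _, true :: _ => True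
  | true :: _, false :: _ => False
  | [], x :: _ => x = true
  | x :: _, [] => x = false
  | [], [] => False
termination_by a b => a.length + b.length

/-- A nonempty word exceeding all its proper suffixes. -/
def WordLexical (w : List Bool) : Prop :=
  w ≠ [] ∧ ∀ u v, u ≠ [] → u ++ v = w → wordLt v w

/-- The concatenation of the blocks `P t`, one for each letter `c` of the given word, with `t`
chosen so that the block `P t` has parity `c`. -/
def wordBlocks (P b : List Bool) : List Bool :=
  b.flatMap fun c => P ++ [xor c (wordParity P)]

/-- The star product of words. -/
def wordStar (P b : List Bool) : List Bool := wordBlocks P b ++ P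

/-- The word of a sequence: each entry `a` becomes `true` followed by `a - 1` times `false`. -/
def toWord (α : List ℕ) : List Bool :=
  α.flatMap fun a => true :: List.replicate (a - 1) false

@[simp] lemma wordParity_nil : wordParity [] = false := rfl

@[simp] lemma wordParity_cons (x : Bool) (w : List Bool) :
    wordParity (x :: w) = xor x (wordParity w) := rfl

@[simp] lemma wordParity_append (a b : List Bool) :
    wordParity (a ++ b) = xor (wordParity a) (wordParity b) := by
  induction a with
  | nil => simp
  | cons x a ih => simp [ih]

lemma wordParity_replicate_false (k : ℕ) : wordParity (List.replicate k false) = false := by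
  induction k with
  | zero => rfl
  | succ k ih => simpa [List.replicate_succ] using ih

@[simp] lemma wordLt_nil_cons (x : Bool) (b : List Bool) : wordLt [] (x :: b) ↔ x = true := by
  simp [wordLt]

@[simp] lemma wordLt_cons_nil (x : Bool) (b : List Bool) : wordLt (x :: b) [] ↔ x = false := by
  simp [wordLt]

@[simp] lemma wordLt_nil_nil : ¬ wordLt [] [] := by simp [wordLt]

@[simp] lemma wordLt_true_true (a b : List Bool) :
    wordLt (true :: a) (true :: b) ↔ wordLt b a := by simp [wordLt]

@[simp] lemma wordLt_false_false (a b : List Bool) :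
    wordLt (false :: a) (false :: b) ↔ wordLt a b := by simp [wordLt]

@[simp] lemma wordLt_false_true (a b : List Bool) : wordLt (false :: a) (true :: b) := by
  simp [wordLt]

@[simp] lemma wordLt_true_false (a b : List Bool) : ¬ wordLt (true :: a) (false :: b) := by
  simp [wordLt]

lemma wordLt_append (p a b : List Bool) :
    wordLt (p ++ a) (p ++ b) ↔ if wordParity p then wordLt b a else wordLt a b := by
  induction p generalizing a b with
  | nil => simp
  | cons x p ih =>
    cases x <;> cases hp : wordParity p <;> simp [ih, hp]

lemma wordLt_irrefl (a : List Bool) : ¬ wordLt a a := by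
  induction a with
  | nil => simp
  | cons x a ih => cases x <;> simpa using ih

lemma wordLt_trans {a b c : List Bool} (h : wordLt a b) (h' : wordLt b c) : wordLt a c := by
  have key : ∀ a b c, (wordLt a b → wordLt b c → wordLt a c) ∧
      (wordLt c b → wordLt b a → wordLt c a) := by
    intro a
    induction a with
    | nil => rintro (_ | ⟨_ | _, b⟩) (_ | ⟨_ | _, c⟩) <;> simp
    | cons x a ih =>
      rintro (_ | ⟨_ | _, b⟩) (_ | ⟨_ | _, c⟩) <;> cases x <;> simp <;>
        grind
  exact (key a b c).1 h h'

lemma wordLt_trichotomy (a b : List Bool) : wordLt a b ∨ a = b ∨ wordLt b a := by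
  induction a generalizing b with
  | nil => rcases b with _ | ⟨_ | _, b⟩ <;> simp
  | cons x a ih =>
    rcases b with _ | ⟨_ | _, b⟩ <;> cases x <;> simp <;> grind

lemma eq_append_or_diverge (a b : List Bool) (h : a.length ≤ b.length) :
    (∃ r, b = a ++ r) ∨ ∃ c x a' b', a = c ++ x :: a' ∧ b = c ++ (!x) :: b' := by
  induction a generalizing b with
  | nil => exact .inl ⟨b, rfl⟩
  | cons x a ih =>
    rcases b with _ | ⟨y, b⟩
    · simp at h
    · by_cases hxy : y = x
      · subst hxy
        rcases ih b (by simpa using h) with ⟨r, rfl⟩ | ⟨c, z, a', b', rfl, rfl⟩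
        · exact .inl ⟨r, rfl⟩
        · exact .inr ⟨y :: c, z, a', b', rfl, rfl⟩
      · exact .inr ⟨[], x, a, b, rfl, by cases x <;> cases y <;> simp_all⟩

lemma eq_append_of_between {P w y z : List Bool} (hl : P.length ≤ w.length)
    (h : wordLt (P ++ y) w) (h' : wordLt w (P ++ z)) : ∃ r, w = P ++ r := by
  rcases eq_append_or_diverge P w hl with hr | ⟨c, x, a', b', rfl, rfl⟩
  · exact hr
  · rw [List.append_assoc, wordLt_append] at h h'
    cases hc : wordParity c <;> cases x <;> simp [hc] at h' h

/-- A shorter word below a longer one either stays below under all extensions, or it is a prefix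
followed by a letter of odd cumulative parity. -/
lemma wordLt.cases_of_length_lt {a b : List Bool} (h : wordLt a b) (hl : a.length < b.length) :
    (∀ y z, wordLt (a ++ y) (b ++ z)) ∨
      ∃ x r, b = a ++ x :: r ∧ wordParity (a ++ [x]) = true := by
  rcases eq_append_or_diverge a b hl.le with ⟨r, rfl⟩ | ⟨c, x, a', b', rfl, rfl⟩
  · rcases r with _ | ⟨x, r⟩
    · simp at hl
    · refine .inr ⟨x, r, rfl, ?_⟩
      have h2 : wordLt (a ++ []) (a ++ x :: r) := by simpa using h
      rw [wordLt_append] at h2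
      cases ha : wordParity a <;> simp_all
  · refine .inl fun y z => ?_
    rw [wordLt_append] at h
    rw [List.append_assoc, List.append_assoc, wordLt_append]
    cases hc : wordParity c <;> cases x <;> simp_all

@[simp] lemma wordBlocks_nil (P : List Bool) : wordBlocks P [] = [] := rfl

lemma wordBlocks_cons (P : List Bool) (c : Bool) (b : List Bool) :
    wordBlocks P (c :: b) = (P ++ [xor c (wordParity P)]) ++ wordBlocks P b := rfl

lemma wordBlocks_append (P a b : List Bool) :
    wordBlocks P (a ++ b) = wordBlocks P a ++ wordBlocks P b := by
  simp [wordBlocks]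

@[simp] lemma wordParity_wordBlocks (P b : List Bool) :
    wordParity (wordBlocks P b) = wordParity b := by
  induction b with
  | nil => rfl
  | cons c b ih =>
    rw [wordBlocks_cons, wordParity_append, ih]
    cases hP : wordParity P <;> simp [hP]

@[simp] lemma length_wordBlocks (P b : List Bool) :
    (wordBlocks P b).length = b.length * (P.length + 1) := by
  induction b with
  | nil => simp
  | cons c b ih => rw [wordBlocks_cons, List.length_append, ih]; simp; ring

lemma wordStar_nil (P : List Bool) : wordStar P [] = P := rfl

lemma wordStar_cons (P : List Bool) (c : Bool) (b : List Bool) :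
    wordStar P (c :: b) = P ++ xor c (wordParity P) :: wordStar P b := by
  simp [wordStar, wordBlocks_cons]

lemma wordStar_append (P a b : List Bool) :
    wordStar P (a ++ b) = wordBlocks P a ++ wordStar P b := by
  simp [wordStar, wordBlocks_append]

lemma exists_wordStar_eq (P b : List Bool) : ∃ r, wordStar P b = P ++ r := by
  cases b with
  | nil => exact ⟨[], by simp [wordStar_nil]⟩
  | cons c b => exact ⟨_, wordStar_cons P c b⟩

lemma wordBlocks_ne_nil {P b : List Bool} (h : b ≠ []) : wordBlocks P b ≠ [] := by
  rcases b with _ | ⟨c, b⟩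
  · exact absurd rfl h
  · simp [wordBlocks_cons]

/-- The star product by `P` on the left preserves and reflects the order. -/
lemma wordLt_wordStar (P b b' : List Bool) :
    wordLt (wordStar P b) (wordStar P b') ↔ wordLt b b' := by
  have aux : ∀ c d : Bool, ∀ b b', wordLt (wordStar P (c :: b)) (wordStar P (d :: b')) ↔
      if wordParity P then wordLt (xor d (wordParity P) :: wordStar P b')
        (xor c (wordParity P) :: wordStar P b)
      else wordLt (xor c (wordParity P) :: wordStar P b)
        (xor d (wordParity P) :: wordStar P b') := by
    intro c d b b'
    rw [wordStar_cons, wordStar_cons, wordLt_append]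
  have auxl : ∀ c b, wordLt (wordStar P []) (wordStar P (c :: b)) ↔ c = true := by
    intro c b
    rw [wordStar_cons, wordStar_nil]
    have := wordLt_append P [] (xor c (wordParity P) :: wordStar P b)
    rw [List.append_nil] at this
    rw [this]
    cases hP : wordParity P <;> cases c <;> simp
  have auxr : ∀ c b, wordLt (wordStar P (c :: b)) (wordStar P []) ↔ c = false := by
    intro c b
    rw [wordStar_cons, wordStar_nil]
    have := wordLt_append P (xor c (wordParity P) :: wordStar P b) []
    rw [List.append_nil] at this
    rw [this]
    cases hP : wordParity P <;> cases c <;> simp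
  induction b, b' using wordLt.induct with
  | case1 a b ih => rw [aux, wordLt_true_true]; cases hP : wordParity P <;> simpa using ih
  | case2 a b ih => rw [aux, wordLt_false_false]; cases hP : wordParity P <;> simpa using ih
  | case3 a b => rw [aux]; cases hP : wordParity P <;> simp
  | case4 a b => rw [aux]; cases hP : wordParity P <;> simp
  | case5 x b => rw [auxl, wordLt_nil_cons]
  | case6 x b => rw [auxr, wordLt_cons_nil]
  | case7 => simp [wordLt_irrefl]

lemma WordLexical.exists_eq_cons {w : List Bool} (h : WordLexical w) : ∃ r, w = true :: r := by
  have h' := h.2 w [] h.1 (by simp)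
  rcases w with _ | ⟨x, r⟩
  · exact absurd rfl h.1
  · exact ⟨r, by rw [(wordLt_nil_cons x r).1 h']⟩

lemma length_lt_of_append_eq {u v w : List Bool} (hu : u ≠ []) (h : u ++ v = w) :
    v.length < w.length := by
  have := List.length_pos_iff.2 hu
  subst h
  simp
  omega

lemma WordLexical.suffix_append_lt {P u P' : List Bool} (hP : WordLexical P) (hu : u ≠ [])
    (h : u ++ P' = P) {s : Bool} (hs : wordParity (P ++ [s]) = true) (t : Bool)
    (Y Z : List Bool) : wordLt (P' ++ t :: (P ++ Y)) (P ++ s :: Z) := by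
  rcases (hP.2 u P' hu h).cases_of_length_lt (length_lt_of_append_eq hu h) with
    hlt | ⟨x, y, hxy, hpar⟩
  · exact hlt _ _
  · have hy' : (P' ++ [x]) ++ y = P := by rw [hxy]; simp
    by_cases htx : t = x
    · subst htx
      have e1 : P' ++ t :: (P ++ Y) = (P' ++ [t]) ++ (P ++ Y) := by simp
      have e2 : P ++ s :: Z = (P' ++ [t]) ++ (y ++ s :: Z) := by
        conv_lhs => rw [← hy']
        simp
      rw [e1, e2, wordLt_append, if_pos hpar]
      rcases (hP.2 (P' ++ [t]) y (by simp) hy').cases_of_length_lt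
        (length_lt_of_append_eq (by simp) hy') with hlt | ⟨x', y', hy, hpar'⟩
      · exact hlt _ _
      · have hsy : xor (wordParity y) s = false := by
          rw [← hy', wordParity_append, wordParity_append, hpar] at hs
          simpa using hs
        rw [hy, List.append_assoc, wordLt_append]
        cases hp : wordParity y <;> cases s <;> cases x' <;> simp_all
    · rw [show P ++ s :: Z = P' ++ x :: (y ++ s :: Z) by rw [hxy]; simp, wordLt_append]
      cases hp : wordParity P' <;> cases t <;> cases x <;> simp_all

lemma suffix_wordStar {P Q u v : List Bool} (h : u ++ v = wordStar P Q) :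
    (∃ Q₁ Q₂, Q = Q₁ ++ Q₂ ∧ u = wordBlocks P Q₁ ∧ v = wordStar P Q₂) ∨
      ∃ u' P', u' ≠ [] ∧ u' ++ P' = P ∧ (v = P' ∨ ∃ t Q', v = P' ++ t :: wordStar P Q') := by
  induction Q generalizing u with
  | nil =>
    by_cases hu : u = []
    · subst hu
      exact .inl ⟨[], [], rfl, rfl, h⟩
    · exact .inr ⟨u, v, hu, h, .inl rfl⟩
  | cons c Q ih =>
    rw [wordStar_cons, List.append_cons, List.append_eq_append_iff] at h
    rcases h with ⟨w, hw, hv⟩ | ⟨w, hu, hw⟩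
    · rcases List.eq_nil_or_concat w with rfl | ⟨P', t, rfl⟩
      · refine .inl ⟨[c], Q, rfl, ?_, by simpa using hv⟩
        simpa [wordBlocks_cons] using hw.symm
      · rw [List.concat_eq_append, ← List.append_assoc] at hw
        obtain ⟨hP, ht⟩ := List.append_inj' hw rfl
        by_cases hu : u = []
        · subst hu
          refine .inl ⟨[], c :: Q, rfl, rfl, ?_⟩
          rw [hv, wordStar_cons]
          simp_all
        · exact .inr ⟨u, P', hu, hP.symm, .inr ⟨t, Q, by simp [hv]⟩⟩
    · rcases ih hw.symm with ⟨Q₁, Q₂, rfl, rfl, rfl⟩ | hr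
      · exact .inl ⟨c :: Q₁, Q₂, rfl, by rw [hu, wordBlocks_cons], rfl⟩
      · exact .inr hr

lemma WordLexical.wordStar {P Q : List Bool} (hP : WordLexical P) (hQ : WordLexical Q) :
    WordLexical (wordStar P Q) := by
  refine ⟨by simp [_root_.wordStar, hP.1], fun u v hu h => ?_⟩
  obtain ⟨Q', hQ'⟩ := hQ.exists_eq_cons
  have hs : wordParity (P ++ [xor true (wordParity P)]) = true := by
    cases hp : wordParity P <;> simp [hp]
  rcases suffix_wordStar h with ⟨Q₁, Q₂, h₁, rfl, rfl⟩ | ⟨u', P', hu', hP', hv⟩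
  · rw [wordLt_wordStar]
    exact hQ.2 Q₁ Q₂ (by rintro rfl; simp at hu) h₁.symm
  · rw [hQ', wordStar_cons]
    rcases hv with rfl | ⟨t, Q₂, rfl⟩
    · rcases (hP.2 u' v hu' hP').cases_of_length_lt (length_lt_of_append_eq hu' hP') with
        hlt | ⟨x, r, hr, hpar⟩
      · simpa using hlt [] (xor true (wordParity P) :: _root_.wordStar P Q')
      · have := wordLt_append v [] (x :: (r ++ xor true (wordParity P) :: _root_.wordStar P Q'))
        rw [List.append_nil] at this
        rw [show P ++ xor true (wordParity P) :: _root_.wordStar P Q' =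
          v ++ x :: (r ++ xor true (wordParity P) :: _root_.wordStar P Q') by
            conv_lhs => rw [hr]
            simp [hr], this]
        cases hp : wordParity v <;> cases x <;> simp_all
    · obtain ⟨Y, hY⟩ := exists_wordStar_eq P Q₂
      rw [hY]
      exact hP.suffix_append_lt hu' hP' hs t Y _

lemma replicate_false_wordLt (w : List Bool) (N : ℕ) (h : w.length < N) :
    wordLt (List.replicate N false) w := by
  induction w generalizing N with
  | nil =>
    obtain ⟨N, rfl⟩ := Nat.exists_eq_succ_of_ne_zero (Nat.ne_of_gt h)
    simp [List.replicate_succ]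
  | cons x w ih =>
    obtain ⟨N, rfl⟩ := Nat.exists_eq_succ_of_ne_zero (by simp at h; omega : N ≠ 0)
    cases x <;> simp [List.replicate_succ]
    exact ih N (by simpa using h)

lemma exists_eq_append_true_replicate (b : List Bool) :
    ∃ b₁ k, true :: b = b₁ ++ true :: List.replicate k false := by
  induction b using List.reverseRecOn with
  | nil => exact ⟨[], 0, rfl⟩
  | append_singleton b x ih =>
    cases x
    · obtain ⟨b₁, k, h⟩ := ih
      refine ⟨b₁, k + 1, ?_⟩
      rw [← List.cons_append, h, List.replicate_succ']
      simp
    · exact ⟨true :: b, 0, rfl⟩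

/-- A lexical word between `P` and `P ⋆ Q`, of the same length as `P ⋆ Q`, is a star product
by `P`. -/
lemma exists_eq_wordStar {P Q g : List Bool} (hQ : WordLexical Q)
    (hg : WordLexical g) (hlen : g.length = (wordStar P Q).length)
    (h₁ : wordLt P g) (h₂ : wordLt g (wordStar P Q)) :
    ∃ b, b.length = Q.length ∧ g = wordStar P b := by
  obtain ⟨Q', rfl⟩ := hQ.exists_eq_cons
  have hlen' : g.length = (Q'.length + 1) * (P.length + 1) + P.length := by
    rw [hlen, wordStar, List.length_append, length_wordBlocks, List.length_cons]
  have hM : wordLt g (wordStar P (true :: List.replicate (Q'.length + 1) false)) := by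
    refine wordLt_trans h₂ ?_
    rw [wordLt_wordStar, wordLt_true_true]
    exact replicate_false_wordLt _ _ (Nat.lt_succ_self _)
  have hgP : ∃ r, g = P ++ r := by
    rw [wordStar_cons] at hM
    refine eq_append_of_between (y := []) ?_ (by simpa using h₁) hM
    rw [hlen']; omega
  have step : ∀ b r, b.length ≤ Q'.length → g = wordBlocks P (true :: b) ++ r →
      ∃ r', r = P ++ r' := by
    intro b r hb hgr
    have hrlen : P.length ≤ r.length := by
      have h3 := congrArg List.length hgr
      rw [hlen', List.length_append, length_wordBlocks, List.length_cons] at h3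
      have := Nat.mul_le_mul_right (P.length + 1) (Nat.succ_le_succ hb)
      simp only [Nat.succ_eq_add_one] at this
      omega
    obtain ⟨b₁, k, hbk⟩ := exists_eq_append_true_replicate b
    have hk : k ≤ b.length := by
      have := congrArg List.length hbk
      simp at this
      omega
    have hmax : ∀ u v, u ++ v = g → v = g ∨ wordLt v g := by
      intro u v h
      by_cases hu : u = []
      · subst hu
        exact .inl h
      · exact .inr (hg.2 u v hu h)
    have hlow : wordLt (wordBlocks P (true :: List.replicate k false) ++ r)
        (wordBlocks P (true :: List.replicate k false) ++
          wordStar P (List.replicate (Q'.length + 1 - k) false)) := by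
      rw [← wordStar_append, List.cons_append, ← List.replicate_add,
        show k + (Q'.length + 1 - k) = Q'.length + 1 by omega]
      rcases hmax (wordBlocks P b₁) (wordBlocks P (true :: List.replicate k false) ++ r)
        (by rw [hgr, hbk, wordBlocks_append, List.append_assoc]) with h | h
      · rwa [h]
      · exact wordLt_trans h hM
    have hpar : wordParity (true :: List.replicate k false) = true := by
      simp [wordParity_replicate_false]
    rw [wordLt_append, wordParity_wordBlocks, if_pos hpar] at hlow
    obtain ⟨y, hy⟩ := exists_wordStar_eq P (List.replicate (Q'.length + 1 - k) false)
    obtain ⟨z, hz⟩ := hgP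
    have hup := hg.2 _ r (wordBlocks_ne_nil (by simp)) hgr.symm
    rw [hy] at hlow
    rw [hz] at hup
    exact eq_append_of_between hrlen hlow hup
  have key : ∀ j ≤ Q'.length, ∃ b r, b.length = j ∧ g = wordBlocks P (true :: b) ++ r := by
    intro j
    induction j with
    | zero =>
      intro _
      obtain ⟨r, hr⟩ := hgP
      rcases r with _ | ⟨x, r⟩
      · rw [hr] at hlen'
        simp at hlen'
      · refine ⟨[], r, rfl, ?_⟩
        have h3 : wordLt (P ++ []) (P ++ x :: r) := by rw [← hr]; simpa using h₁
        rw [wordLt_append] at h3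
        rw [hr]
        cases hp : wordParity P <;> cases x <;> simp_all [wordBlocks_cons]
    | succ j ih =>
      intro hj
      obtain ⟨b, r, hb, hgr⟩ := ih (by omega)
      obtain ⟨r', rfl⟩ := step b r (by omega) hgr
      rcases r' with _ | ⟨x, r'⟩
      · have h3 := congrArg List.length hgr
        rw [hlen', List.length_append, length_wordBlocks, List.length_cons, hb] at h3
        have := Nat.mul_lt_mul_of_pos_right (Nat.succ_lt_succ hj) (Nat.succ_pos P.length)
        simp at h3
        omega
      · refine ⟨b ++ [xor x (wordParity P)], r', by simp [hb], ?_⟩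
        rw [hgr, ← List.cons_append, wordBlocks_append]
        simp [wordBlocks_cons]
  obtain ⟨b, r, hb, hgr⟩ := key _ le_rfl
  obtain ⟨r', rfl⟩ := step b r hb.le hgr
  refine ⟨true :: b, by simp [hb], ?_⟩
  have h3 := congrArg List.length hgr
  rw [hlen', List.length_append, length_wordBlocks, List.length_cons, hb,
    List.length_append] at h3
  have hr' : r' = [] := List.length_eq_zero_iff.1 (by omega)
  rw [hgr, hr', List.append_nil, wordStar]

lemma WordLexical.of_wordStar {P b : List Bool} (h : WordLexical (_root_.wordStar P b))
    (hb : b ≠ []) : WordLexical b := by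
  refine ⟨hb, fun u v hu huv => ?_⟩
  rw [← wordLt_wordStar P]
  refine h.2 (wordBlocks P u) _ (wordBlocks_ne_nil hu) ?_
  rw [← wordStar_append, huv]

@[simp] lemma toWord_nil : toWord [] = [] := rfl

lemma toWord_cons (a : ℕ) (α : List ℕ) :
    toWord (a :: α) = true :: (List.replicate (a - 1) false ++ toWord α) := rfl

lemma toWord_append (α β : List ℕ) : toWord (α ++ β) = toWord α ++ toWord β := by
  simp [toWord]

lemma length_toWord {α : List ℕ} (h : ∀ x ∈ α, 0 < x) : (toWord α).length = α.sum := by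
  induction α with
  | nil => rfl
  | cons a α ih =>
    have ha := h a (by simp)
    have := ih fun x hx => h x (by simp [hx])
    simp [toWord_cons, this]
    omega

lemma toWord_ne_nil {α : List ℕ} (h : α ≠ []) : toWord α ≠ [] := by
  rcases α with _ | ⟨a, α⟩
  · exact absurd rfl h
  · simp [toWord_cons]

lemma wordParity_toWord (α : List ℕ) : wordParity (toWord α) = !decide (Even α.length) := by
  induction α with
  | nil => rfl
  | cons a α ih =>
    simp [toWord_cons, wordParity_replicate_false, ih, Nat.even_add_one, -Nat.not_even_iff_odd]

lemma exists_toWord_eq (w : List Bool) :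
    ∃ k α, (∀ x ∈ α, 0 < x) ∧ w = List.replicate k false ++ toWord α := by
  induction w with
  | nil => exact ⟨0, [], by simp, rfl⟩
  | cons x w ih =>
    obtain ⟨k, α, hα, rfl⟩ := ih
    cases x
    · exact ⟨k + 1, α, hα, by simp [List.replicate_succ]⟩
    · exact ⟨0, (k + 1) :: α, by simpa using hα, by simp [toWord_cons]⟩

lemma WordLexical.exists_toWord_eq {w : List Bool} (h : WordLexical w) :
    ∃ α, IsAlphaSeq α ∧ toWord α = w := by
  obtain ⟨k, α, hα, hw⟩ := _root_.exists_toWord_eq w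
  obtain ⟨r, rfl⟩ := h.exists_eq_cons
  rcases k with _ | k
  · refine ⟨α, ⟨?_, hα⟩, by simpa using hw.symm⟩
    rintro rfl
    simp at hw
  · simp [List.replicate_succ] at hw

lemma Al_cons_succ (a : ℕ) (α : List ℕ) (i : ℕ) : Al (a :: α) (i + 1) = -Al α i := by
  simp [Al, pow_succ]

lemma lexLt_cons_cons (a b : ℕ) (α β : List ℕ) :
    lexLt (a :: α) (b :: β) ↔ a < b ∨ a = b ∧ lexLt β α := by
  constructor
  · rintro ⟨i, hi, hlt⟩
    rcases i with _ | i
    · left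
      simpa [Al] using hlt
    · refine .inr ⟨by simpa [Al] using hi 0 (by omega), i, fun j hj => ?_, ?_⟩
      · have := hi (j + 1) (by omega)
        rw [Al_cons_succ, Al_cons_succ] at this
        omega
      · rw [Al_cons_succ, Al_cons_succ] at hlt
        omega
  · rintro (h | ⟨rfl, i, hi, hlt⟩)
    · exact ⟨0, by simp, by simpa [Al] using h⟩
    · refine ⟨i + 1, fun j hj => ?_, ?_⟩
      · rcases j with _ | j
        · simp [Al]
        · rw [Al_cons_succ, Al_cons_succ, hi j (by omega)]
      · rw [Al_cons_succ, Al_cons_succ]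
        omega

lemma lexLt_nil_cons {b : ℕ} (β : List ℕ) (hb : 0 < b) : lexLt [] (b :: β) :=
  ⟨0, by simp, by simpa [Al] using hb⟩

lemma not_lexLt_nil_nil : ¬ lexLt [] [] := by
  rintro ⟨i, -, h⟩
  exact lt_irrefl _ h

lemma not_lexLt_cons_nil {a : ℕ} (α : List ℕ) (ha : 0 < a) : ¬ lexLt (a :: α) [] := by
  rintro ⟨i, hi, h⟩
  rcases i with _ | i
  · simp [Al] at h
    omega
  · have := hi 0 (by omega)
    simp [Al] at this
    omega

lemma false_cons_wordLt_toWord (w : List Bool) (α : List ℕ) :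
    wordLt (false :: w) (toWord α) := by
  cases α <;> simp [toWord_cons]

lemma not_toWord_wordLt_false_cons (w : List Bool) (α : List ℕ) :
    ¬ wordLt (toWord α) (false :: w) := by
  cases α <;> simp [toWord_cons]

lemma wordLt_toWord_cons_cons {a b : ℕ} (ha : 0 < a) (hb : 0 < b) (α β : List ℕ) :
    wordLt (toWord (a :: α)) (toWord (b :: β)) ↔
      a < b ∨ a = b ∧ wordLt (toWord β) (toWord α) := by
  have hrep : ∀ (k : ℕ) (u v : List Bool), wordLt (List.replicate k false ++ u)
      (List.replicate k false ++ v) ↔ wordLt u v := by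
    intro k u v
    rw [wordLt_append, wordParity_replicate_false]
    simp
  rw [toWord_cons, toWord_cons, wordLt_true_true]
  rcases lt_trichotomy a b with h | rfl | h
  · obtain ⟨k, rfl⟩ := Nat.exists_eq_add_of_lt h
    rw [show a + k + 1 - 1 = (a - 1) + (k + 1) by omega, List.replicate_add, List.append_assoc,
      hrep]
    simp [List.replicate_succ, false_cons_wordLt_toWord, h]
  · simp [hrep]
  · obtain ⟨k, rfl⟩ := Nat.exists_eq_add_of_lt h
    rw [show b + k + 1 - 1 = (b - 1) + (k + 1) by omega, List.replicate_add, List.append_assoc,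
      hrep]
    simp [List.replicate_succ, not_toWord_wordLt_false_cons]
    omega

lemma lexLt_iff_wordLt {α β : List ℕ} (hα : ∀ x ∈ α, 0 < x) (hβ : ∀ x ∈ β, 0 < x) :
    lexLt α β ↔ wordLt (toWord α) (toWord β) := by
  have key : ∀ α β : List ℕ, (∀ x ∈ α, 0 < x) → (∀ x ∈ β, 0 < x) →
      (lexLt α β ↔ wordLt (toWord α) (toWord β)) ∧
        (lexLt β α ↔ wordLt (toWord β) (toWord α)) := by
    intro α
    induction α with
    | nil =>
      rintro (_ | ⟨b, β⟩) - hβ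
      · simp [not_lexLt_nil_nil]
      · have hb := hβ b (by simp)
        simp [toWord_cons, lexLt_nil_cons β hb, not_lexLt_cons_nil β hb]
    | cons a α ih =>
      rintro (_ | ⟨b, β⟩) hα hβ
      · have ha := hα a (by simp)
        simp [toWord_cons, lexLt_nil_cons α ha, not_lexLt_cons_nil α ha]
      · have ha := hα a (by simp)
        have hb := hβ b (by simp)
        obtain ⟨ih₁, ih₂⟩ := ih β (fun x hx => hα x (by simp [hx])) fun x hx => hβ x (by simp [hx])
        rw [wordLt_toWord_cons_cons ha hb, wordLt_toWord_cons_cons hb ha, lexLt_cons_cons,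
          lexLt_cons_cons, ih₁, ih₂]
        exact ⟨Iff.rfl, Iff.rfl⟩
  exact (key α β hα hβ).1

lemma toWord_injective {α β : List ℕ} (hα : ∀ x ∈ α, 0 < x) (hβ : ∀ x ∈ β, 0 < x)
    (h : toWord α = toWord β) : α = β := by
  induction α generalizing β with
  | nil => cases β <;> simp_all [toWord_cons]
  | cons a α ih =>
    rcases β with _ | ⟨b, β⟩
    · simp [toWord_cons] at h
    · have hlt := fun h' => (wordLt_toWord_cons_cons (hα a (by simp)) (hβ b (by simp)) α β).2
        (.inl h')
      have hgt := fun h' => (wordLt_toWord_cons_cons (hβ b (by simp)) (hα a (by simp)) β α).2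
        (.inl h')
      rw [h] at hlt hgt
      have hab : a = b := by
        rcases lt_trichotomy a b with h' | h' | h'
        · exact absurd (hlt h') (wordLt_irrefl _)
        · exact h'
        · exact absurd (hgt h') (wordLt_irrefl _)
      subst hab
      rw [@ih β (fun x hx => hα x (by simp [hx])) (fun x hx => hβ x (by simp [hx]))
        (by simpa [toWord_cons] using h)]

lemma suffix_toWord {α : List ℕ} {u v : List Bool} (hu : u ≠ []) (h : u ++ v = toWord α) :
    ∃ k i, 1 ≤ i ∧ i ≤ α.length ∧ v = List.replicate k false ++ toWord (α.drop i) := by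
  induction α generalizing u with
  | nil => simp [hu] at h
  | cons a α ih =>
    obtain ⟨x, u, rfl⟩ := List.exists_cons_of_ne_nil hu
    rw [toWord_cons, List.cons_append, List.cons.injEq, List.append_eq_append_iff] at h
    rcases h.2 with ⟨w, hw, hv⟩ | ⟨w, hu', hw⟩
    · refine ⟨w.length, 1, le_rfl, by simp, ?_⟩
      rw [hv, List.drop_one, List.tail_cons,
        List.eq_replicate_length.2 fun b hb => List.eq_of_mem_replicate
          (hw ▸ List.mem_append_right u hb : b ∈ List.replicate (a - 1) false)]
      simp
    · by_cases hw' : w = []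
      · subst hw'
        exact ⟨0, 1, le_rfl, by simp, by simpa using hw.symm⟩
      · obtain ⟨k, i, h1, hi, hv⟩ := ih hw' hw.symm
        exact ⟨k, i + 1, by omega, by simpa using hi, by simpa using hv⟩

lemma isLexical_iff (α : List ℕ) : IsLexical α ↔ IsAlphaSeq α ∧ WordLexical (toWord α) := by
  have hdrop : IsAlphaSeq α → ∀ i, ∀ x ∈ α.drop i, 0 < x :=
    fun h i x hx => h.2 x (List.mem_of_mem_drop hx)
  constructor
  · rintro ⟨hα, hlex⟩
    refine ⟨hα, toWord_ne_nil hα.1, fun u v hu h => ?_⟩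
    obtain ⟨k, i, h1, hi, rfl⟩ := suffix_toWord hu h
    rcases k with _ | k
    · rcases hi.eq_or_lt with rfl | hi
      · obtain ⟨a, β, rfl⟩ := List.exists_cons_of_ne_nil hα.1
        simp [toWord_cons]
      · have := hlex (i + 1) (by omega) hi
        simpa [lexLt_iff_wordLt (hdrop hα i) hα.2] using this
    · rw [List.replicate_succ, List.cons_append]
      exact false_cons_wordLt_toWord _ _
  · rintro ⟨hα, hlex⟩
    refine ⟨hα, fun i h2 hi => ?_⟩
    rw [lexLt_iff_wordLt (hdrop hα _) hα.2]
    refine hlex.2 (toWord (α.take (i - 1))) _ (toWord_ne_nil fun h => ?_) ?_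
    · have := congrArg List.length h
      rw [List.length_take, List.length_nil] at this
      omega
    · rw [← toWord_append, List.take_append_drop]

lemma mem_Lset_iff (n : ℕ) (α : List ℕ) :
    α ∈ Lset n ↔ IsAlphaSeq α ∧ WordLexical (toWord α) ∧ 1 + (toWord α).length = n := by
  constructor
  · rintro ⟨h, hn⟩
    obtain ⟨h1, h2⟩ := (isLexical_iff α).1 h
    exact ⟨h1, h2, by rwa [length_toWord h1.2]⟩
  · rintro ⟨h1, h2, hn⟩
    exact ⟨(isLexical_iff α).2 ⟨h1, h2⟩, by rwa [length_toWord h1.2] at hn⟩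

lemma bumpLast_append_singleton (α : List ℕ) (a : ℕ) :
    bumpLast (α ++ [a]) = α ++ [a + 1] := by
  simp [bumpLast]

lemma toWord_bumpLast {α : List ℕ} (h : IsAlphaSeq α) :
    toWord (bumpLast α) = toWord α ++ [false] := by
  rcases List.eq_nil_or_concat α with rfl | ⟨β, a, rfl⟩
  · exact absurd rfl h.1
  · have ha := h.2 a (by simp)
    obtain ⟨a, rfl⟩ := Nat.exists_eq_succ_of_ne_zero ha.ne'
    rw [List.concat_eq_append, bumpLast_append_singleton, toWord_append, toWord_append]
    simp [toWord_cons, List.replicate_succ']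

lemma toWord_concat_one (α : List ℕ) : toWord (α ++ [1]) = toWord α ++ [true] := by
  rw [toWord_append]
  rfl

lemma toWord_seqE {α : List ℕ} (h : IsAlphaSeq α) :
    toWord (seqE α) = toWord α ++ [xor false (wordParity (toWord α))] := by
  rw [seqE, wordParity_toWord]
  split_ifs with he <;> simp [he, toWord_bumpLast h, toWord_concat_one]

lemma toWord_seqO {α : List ℕ} (h : IsAlphaSeq α) :
    toWord (seqO α) = toWord α ++ [xor true (wordParity (toWord α))] := by
  rw [seqO, wordParity_toWord]
  split_ifs with he <;> simp [he, toWord_bumpLast h, toWord_concat_one]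

lemma toWord_nrep_seqE {α : List ℕ} (h : IsAlphaSeq α) (k : ℕ) :
    toWord (nrep (seqE α) k) = wordBlocks (toWord α) (List.replicate k false) := by
  induction k with
  | zero => rfl
  | succ k ih =>
    rw [List.replicate_succ, wordBlocks_cons, ← ih, ← toWord_seqE h, ← toWord_append]
    simp [nrep, List.replicate_succ]

lemma toWord_starProd {α : List ℕ} (h : IsAlphaSeq α) (β : List ℕ) :
    toWord (starProd α β) = wordStar (toWord α) (toWord β) := by
  rw [starProd, toWord_append, wordStar]
  congr 1
  induction β with
  | nil => rfl
  | cons b β ih =>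
    rw [List.map_cons, List.flatten_cons, toWord_append, ih, toWord_append, toWord_seqO h,
      toWord_nrep_seqE h, toWord_cons, wordBlocks_cons, wordBlocks_append, List.append_assoc]

lemma pos_of_mem_bumpLast {α : List ℕ} (h : ∀ x ∈ α, 0 < x) : ∀ x ∈ bumpLast α, 0 < x := by
  intro x hx
  rcases List.mem_append.1 hx with hx | hx
  · exact h x (List.mem_of_mem_dropLast hx)
  · rw [List.mem_singleton.1 hx]
    omega

lemma isAlphaSeq_starProd {α : List ℕ} (h : IsAlphaSeq α) (β : List ℕ) :
    IsAlphaSeq (starProd α β) := by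
  have hone : ∀ x ∈ α ++ [1], 0 < x := by
    intro x hx
    rcases List.mem_append.1 hx with hx | hx
    · exact h.2 x hx
    · rw [List.mem_singleton.1 hx]
      exact one_pos
  have hE : ∀ x ∈ seqE α, 0 < x := by
    rw [seqE]
    split_ifs
    exacts [pos_of_mem_bumpLast h.2, hone]
  have hO : ∀ x ∈ seqO α, 0 < x := by
    rw [seqO]
    split_ifs
    exacts [hone, pos_of_mem_bumpLast h.2]
  refine ⟨by simp [starProd, h.1], fun x hx => ?_⟩
  rcases List.mem_append.1 hx with hx | hx
  · obtain ⟨l, hl, hx⟩ := List.mem_flatten.1 hx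
    obtain ⟨b, -, rfl⟩ := List.mem_map.1 hl
    rcases List.mem_append.1 hx with hx | hx
    · exact hO x hx
    · obtain ⟨l, hl, hx⟩ := List.mem_flatten.1 hx
      exact hE x (List.eq_of_mem_replicate hl ▸ hx)
  · exact h.2 x hx

/-- if `f̂ ∈ L_m` (with `m ∣ n`, `2 ≤ m < n`) lies strictly between
adjacent elements `α < α'` of `L_n`, then `α' = f̂ ⋆ λ` with `λ` least in `L_{n/m}`. -/
theorem stmt_16 (n : ℕ) (hn : 2 ≤ n) (α α' : List ℕ)
    (hα : α ∈ Lset n) (hα' : α' ∈ Lset n)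
    (hadj : AdjLtIn (Lset n) α α')
    (m : ℕ) (hm : 2 ≤ m) (hmn : m < n) (hdvd : m ∣ n)
    (fhat : List ℕ) (hf : fhat ∈ Lset m)
    (h1 : lexLt α fhat) (h2 : lexLt fhat α')
    (lam : List ℕ) (hlam : LeastIn (Lset (n / m)) lam) :
    α' = starProd fhat lam := by
  obtain ⟨hfα, hfw, hfl⟩ := (mem_Lset_iff m fhat).1 hf
  obtain ⟨hlα, hlw, hll⟩ := (mem_Lset_iff (n / m) lam).1 hlam.1
  obtain ⟨hgα, hgw, hgl⟩ := (mem_Lset_iff n α').1 hα'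
  obtain ⟨haα, -, -⟩ := (mem_Lset_iff n α).1 hα
  have hsα := isAlphaSeq_starProd hfα lam
  have hsw := toWord_starProd hfα lam
  have hnm : m * (n / m) = n := Nat.mul_div_cancel' hdvd
  have hslen : 1 + (wordStar (toWord fhat) (toWord lam)).length = n := by
    rw [wordStar, List.length_append, length_wordBlocks, ← hnm, ← hll, ← hfl]
    ring
  rw [lexLt_iff_wordLt haα.2 hfα.2] at h1
  rw [lexLt_iff_wordLt hfα.2 hgα.2] at h2
  have hfs : wordLt (toWord fhat) (wordStar (toWord fhat) (toWord lam)) := by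
    obtain ⟨r, hr⟩ := hlw.exists_eq_cons
    rw [hr]
    exact (wordLt_wordStar (toWord fhat) [] (true :: r)).2 (by simp)
  apply toWord_injective hgα.2 hsα.2
  rw [hsw]
  rcases wordLt_trichotomy (toWord α') (wordStar (toWord fhat) (toWord lam)) with h | h | h
  · exfalso
    obtain ⟨b, hb, hgb⟩ := exists_eq_wordStar hlw hgw (by omega) h2 h
    rw [hgb] at hgw h
    rw [wordLt_wordStar] at h
    have hbw : WordLexical b := hgw.of_wordStar fun h0 =>
      hlw.1 (List.length_eq_zero_iff.1 (by rw [← hb, h0]; rfl))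
    obtain ⟨β, hβ, rfl⟩ := hbw.exists_toWord_eq
    have hβL : β ∈ Lset (n / m) := (mem_Lset_iff _ _).2 ⟨hβ, hbw, by omega⟩
    have hlt := hlam.2 β hβL (by rintro rfl; exact wordLt_irrefl _ h)
    rw [lexLt_iff_wordLt hlα.2 hβ.2] at hlt
    exact wordLt_irrefl _ (wordLt_trans h hlt)
  · exact h
  · refine absurd ?_ (hadj.2 (starProd fhat lam)
      ((mem_Lset_iff _ _).2 ⟨hsα, by rw [hsw]; exact hfw.wordStar hlw, by rw [hsw]; exact hslen⟩))
    rw [lexLt_iff_wordLt haα.2 hsα.2, lexLt_iff_wordLt hsα.2 hgα.2, hsw]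
    exact ⟨wordLt_trans h1 hfs, h⟩
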